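/- Let α ∈ (1/2, 1), set η = (1−α)/α ∈ (0,1), let β ∈ (0,1), and let Y be an integrable random variable. Then the higher order expectile satisfies inf_{t ∈ ℝ} ( t + (1−β)^{-1}·e_α((Y−t)₊) ) = max_{γ ∈ [0, 1−η]} g(γ), where g(γ) = (1 − γ/(1−β))·AVaR_{β/(1−γ)}(Y) + (γ/(1−β))·AVaR_{1−(γ/(1−γ))·(η/(1−η))}(Y) whenever γ/(1−β) < 1−η (with the convention that a term with coefficient 0 is 0), and g(γ) = AVaR_{1−(1−β)·η/(1−γ)}(Y) otherwise. -/

import Mathlib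

open MeasureTheory Set

/-- Cumulative distribution function `F_Y(x) = P(Y ≤ x)`. -/
noncomputable def cdfR {Ω : Type*} [MeasurableSpace Ω] (P : Measure Ω) (Y : Ω → ℝ)
    (x : ℝ) : ℝ :=
  (P {ω | Y ω ≤ x}).toReal

/-- Quantile function `F_Y⁻¹(u) = inf {x : F_Y(x) ≥ u}`. -/
noncomputable def quantR {Ω : Type*} [MeasurableSpace Ω] (P : Measure Ω) (Y : Ω → ℝ)
    (u : ℝ) : ℝ :=
  sInf {x : ℝ | u ≤ cdfR P Y x}

/-- Average value-at-risk `AVaR_α(Y) = (1-α)⁻¹ ∫_α^1 F_Y⁻¹(u) du`. -/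
noncomputable def avarR {Ω : Type*} [MeasurableSpace Ω] (P : Measure Ω) (α : ℝ)
    (Y : Ω → ℝ) : ℝ :=
  (1 - α)⁻¹ * ∫ u in α..1, quantR P Y u

theorem minimax_aux {ι : Type*} (S : Set ι) (A B : ι → ℝ)
    (hc : ∀ z ∈ S, ∀ w ∈ S, ∀ p r : ℝ, 0 < p → 0 < r → p + r = 1 →
      ∃ y ∈ S, A y ≤ p * A z + r * A w ∧ B y ≤ p * B z + r * B w)
    (hm : ∀ z ∈ S, 0 ≤ A z ∨ 0 ≤ B z) :
    ∃ θ : ℝ, 0 ≤ θ ∧ θ ≤ 1 ∧ ∀ z ∈ S, 0 ≤ (1 - θ) * A z + θ * B z := by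
  set T : Set ℝ := insert 0 ((fun z => -A z / (B z - A z)) '' {z | z ∈ S ∧ A z < 0}) with hT
  have hne : T.Nonempty := ⟨0, by simp [hT]⟩
  have hub1 : ∀ x ∈ T, x ≤ 1 := by
    intro x hx
    rcases hx with rfl | ⟨z, ⟨hz, hA⟩, rfl⟩
    · norm_num
    · have hB : 0 ≤ B z := (hm z hz).resolve_left (not_le.2 hA)
      show -A z / (B z - A z) ≤ 1
      rw [div_le_one (by linarith)]
      linarith
  have hbdd : BddAbove T := ⟨1, hub1⟩
  refine ⟨sSup T, le_csSup hbdd (by simp [hT]), csSup_le hne hub1, ?_⟩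
  intro z hz
  have h0 : 0 ≤ sSup T := le_csSup hbdd (by simp [hT])
  have h1 : sSup T ≤ 1 := csSup_le hne hub1
  by_cases hA : A z < 0
  · have hB : 0 ≤ B z := (hm z hz).resolve_left (not_le.2 hA)
    have h2 : -A z / (B z - A z) ≤ sSup T := le_csSup hbdd (Or.inr ⟨z, ⟨hz, hA⟩, rfl⟩)
    rw [div_le_iff₀ (by linarith)] at h2
    linarith
  · push Not at hA
    by_cases hB : B z < 0
    · have h2 : sSup T ≤ A z / (A z - B z) := by
        refine csSup_le hne ?_
        intro x hx
        rcases hx with rfl | ⟨y, ⟨hy, hAy⟩, rfl⟩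
        · exact div_nonneg hA (by linarith)
        · have hBy : 0 ≤ B y := (hm y hy).resolve_left (not_le.2 hAy)
          show -A y / (B y - A y) ≤ _
          rw [div_le_div_iff₀ (by linarith) (by linarith)]
          by_contra hcon
          push Not at hcon
          have hp : 0 < A z - B z := by linarith
          have hr : 0 < B y - A y := by linarith
          have hs : 0 < (A z - B z) + (B y - A y) := by linarith
          obtain ⟨w, hw, hw1, hw2⟩ := hc y hy z hz ((A z - B z) / ((A z - B z) + (B y - A y)))
            ((B y - A y) / ((A z - B z) + (B y - A y))) (by positivity) (by positivity)
            (by field_simp)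
          have e1 : (A z - B z) / ((A z - B z) + (B y - A y)) * A y +
            (B y - A y) / ((A z - B z) + (B y - A y)) * A z < 0 := by
            have : (A z - B z) / ((A z - B z) + (B y - A y)) * A y +
              (B y - A y) / ((A z - B z) + (B y - A y)) * A z =
              (B y * A z - A y * B z) / ((A z - B z) + (B y - A y)) := by
              field_simp; ring
            rw [this]
            exact div_neg_of_neg_of_pos (by linarith) hs
          have e2 : (A z - B z) / ((A z - B z) + (B y - A y)) * B y +
            (B y - A y) / ((A z - B z) + (B y - A y)) * B z < 0 := by
            have : (A z - B z) / ((A z - B z) + (B y - A y)) * B y +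
              (B y - A y) / ((A z - B z) + (B y - A y)) * B z =
              (B y * A z - A y * B z) / ((A z - B z) + (B y - A y)) := by
              field_simp; ring
            rw [this]
            exact div_neg_of_neg_of_pos (by linarith) hs
          rcases hm w hw with h | h <;> linarith
      rw [le_div_iff₀ (by linarith)] at h2
      linarith
    · push Not at hB
      have : 0 ≤ 1 - sSup T := by linarith
      positivity

section quant
variable {Ω : Type*} [MeasurableSpace Ω] (P : Measure Ω) [IsProbabilityMeasure P]
  (Y : Ω → ℝ) (hY : Integrable Y P)

theorem cdfR_eq (hY : Integrable Y P) (x : ℝ) :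
    cdfR P Y x = ProbabilityTheory.cdf (P.map Y) x := by
  have := Measure.isProbabilityMeasure_map (μ := P) hY.aemeasurable
  rw [ProbabilityTheory.cdf_eq_real, measureReal_def,
    Measure.map_apply_of_aemeasurable hY.aemeasurable measurableSet_Iic]
  rfl

theorem quantR_le_iff (hY : Integrable Y P) {u : ℝ} (h0 : 0 < u) (h1 : u < 1) (x : ℝ) :
    quantR P Y u ≤ x ↔ u ≤ cdfR P Y x := by
  have := Measure.isProbabilityMeasure_map (μ := P) hY.aemeasurable
  unfold quantR
  simp only [cdfR_eq P Y hY]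
  set F := ProbabilityTheory.cdf (P.map Y) with hF
  have hbd : BddBelow {x : ℝ | u ≤ F x} := by
    have := (ProbabilityTheory.tendsto_cdf_atBot (P.map Y)).eventually (gt_mem_nhds h0)
    obtain ⟨b, hb⟩ := this.exists
    refine ⟨b, fun y hy => ?_⟩
    by_contra hlt
    push Not at hlt
    have := F.mono hlt.le
    simp only [mem_ofPred_eq] at hy
    linarith
  have hne : {x : ℝ | u ≤ F x}.Nonempty := by
    have := (ProbabilityTheory.tendsto_cdf_atTop (P.map Y)).eventually (lt_mem_nhds h1)
    obtain ⟨b, hb⟩ := this.exists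
    exact ⟨b, hb.le⟩
  constructor
  · intro h
    have hy : ∀ y, x < y → u ≤ F y := by
      intro y hxy
      obtain ⟨z, hz, hzy⟩ := (csInf_lt_iff hbd hne).1 (lt_of_le_of_lt h hxy)
      exact le_trans hz (F.mono hzy.le)
    have hr := F.right_continuous x
    have ht : Filter.Tendsto F (nhdsWithin x (Ioi x)) (nhds (F x)) :=
      hr.mono_left (nhdsWithin_mono _ Ioi_subset_Ici_self)
    refine ge_of_tendsto ht ?_
    filter_upwards [self_mem_nhdsWithin] with y hxy using hy y hxy
  · intro h
    exact csInf_le hbd h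

theorem quantR_mono (hY : Integrable Y P) : MonotoneOn (quantR P Y) (Ioo 0 1) := by
  intro u hu v hv huv
  rw [quantR_le_iff P Y hY hu.1 hu.2]
  exact huv.trans ((quantR_le_iff P Y hY hv.1 hv.2 _).1 le_rfl)

theorem quantR_aem (hY : Integrable Y P) :
    AEMeasurable (quantR P Y) (volume.restrict (Ioo (0:ℝ) 1)) :=
  aemeasurable_restrict_of_monotoneOn measurableSet_Ioo (quantR_mono P Y hY)

theorem quantR_map (hY : Integrable Y P) :
    (volume.restrict (Ioo (0:ℝ) 1)).map (quantR P Y) = P.map Y := by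
  have := Measure.isProbabilityMeasure_map (μ := P) hY.aemeasurable
  symm
  refine Measure.ext_of_Iic _ _ (fun x => ?_)
  rw [Measure.map_apply_of_aemeasurable (quantR_aem P Y hY) measurableSet_Iic,
    Measure.restrict_apply' measurableSet_Ioo]
  rw [← ProbabilityTheory.ofReal_cdf, ← cdfR_eq P Y hY]
  have h0 : 0 ≤ cdfR P Y x := ENNReal.toReal_nonneg
  have h1 : cdfR P Y x ≤ 1 := by
    rw [cdfR_eq P Y hY]; exact ProbabilityTheory.cdf_le_one _ _
  have : quantR P Y ⁻¹' Iic x ∩ Ioo 0 1 = Ioc 0 (cdfR P Y x) ∩ Ioo 0 1 := by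
    ext u
    simp only [mem_inter_iff, mem_preimage, mem_Iic, mem_Ioo, mem_Ioc]
    constructor
    · rintro ⟨h, hu0, hu1⟩
      exact ⟨⟨hu0, (quantR_le_iff P Y hY hu0 hu1 x).1 h⟩, hu0, hu1⟩
    · rintro ⟨⟨_, h⟩, hu0, hu1⟩
      exact ⟨(quantR_le_iff P Y hY hu0 hu1 x).2 h, hu0, hu1⟩
  rw [this]
  apply le_antisymm
  · have : Ioo 0 (cdfR P Y x) ⊆ Ioc 0 (cdfR P Y x) ∩ Ioo 0 1 :=
      fun u hu => ⟨⟨hu.1, hu.2.le⟩, hu.1, lt_of_lt_of_le hu.2 h1⟩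
    refine le_trans (le_of_eq ?_) (measure_mono this)
    simp
  · refine le_trans (measure_mono inter_subset_left) (le_of_eq ?_)
    simp

theorem quantR_integrable (hY : Integrable Y P) :
    Integrable (quantR P Y) (volume.restrict (Ioo (0:ℝ) 1)) := by
  have h : Integrable (fun x : ℝ => x) (P.map Y) :=
    (integrable_map_measure (by fun_prop) hY.aemeasurable).2 hY
  rw [← quantR_map P Y hY] at h
  exact (integrable_map_measure (by fun_prop) (quantR_aem P Y hY)).1 h

theorem quantR_M (hY : Integrable Y P) (t : ℝ) :
    ∫ ω, max (Y ω - t) 0 ∂P = ∫ u in Ioo (0:ℝ) 1, max (quantR P Y u - t) 0 := by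
  have h1 := integral_map (f := fun x : ℝ => max (x - t) 0) hY.aemeasurable
    (by apply Continuous.aestronglyMeasurable; fun_prop)
  have h2 := integral_map (f := fun x : ℝ => max (x - t) 0) (quantR_aem P Y hY)
    (by apply Continuous.aestronglyMeasurable; fun_prop)
  rw [quantR_map P Y hY] at h2
  rw [← h1, h2]

theorem avar_form (hY : Integrable Y P) {u : ℝ} (h0 : 0 < u) (h1 : u < 1) (t : ℝ) :
    avarR P u Y = t + (1 - u)⁻¹ * ∫ v in Ioo u 1, (quantR P Y v - t) := by
  have hi : IntegrableOn (quantR P Y) (Ioo u 1) :=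
    IntegrableOn.mono_set (quantR_integrable P Y hY) (Ioo_subset_Ioo_left h0.le)
  rw [integral_sub hi (by simp)]
  unfold avarR
  rw [intervalIntegral.integral_of_le h1.le, integral_Ioc_eq_integral_Ioo]
  have : (1 - u) ≠ 0 := by linarith
  simp [h1.le]
  field_simp
  ring

theorem split_int (hY : Integrable Y P) {u : ℝ} (h0 : 0 < u) (h1 : u < 1) (t : ℝ) :
    ∫ v in Ioo (0:ℝ) 1, max (quantR P Y v - t) 0 =
    (∫ v in Ioc (0:ℝ) u, max (quantR P Y v - t) 0) + ∫ v in Ioo u 1, max (quantR P Y v - t) 0 := by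
  have hi : IntegrableOn (fun v => max (quantR P Y v - t) 0) (Ioo (0:ℝ) 1) :=
    (Integrable.sub (quantR_integrable P Y hY) (by simp)).pos_part
  rw [← Ioc_union_Ioo_eq_Ioo h0.le h1]
  refine setIntegral_union ?_ measurableSet_Ioo (hi.mono_set ?_) (hi.mono_set ?_)
  · rw [Set.disjoint_left]; intro x hx hx'; exact absurd hx.2 (not_le.2 hx'.1)
  · intro x hx; exact ⟨hx.1, lt_of_le_of_lt hx.2 h1⟩
  · exact Ioo_subset_Ioo_left h0.le

theorem avar_le (hY : Integrable Y P) {u : ℝ} (h0 : 0 < u) (h1 : u < 1) (t : ℝ) :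
    avarR P u Y ≤ t + (1 - u)⁻¹ * ∫ ω, max (Y ω - t) 0 ∂P := by
  have hi : IntegrableOn (quantR P Y) (Ioo u 1) :=
    IntegrableOn.mono_set (quantR_integrable P Y hY) (Ioo_subset_Ioo_left h0.le)
  have hi2 : IntegrableOn (fun v => quantR P Y v - t) (Ioo u 1) := Integrable.sub hi (by simp)
  rw [avar_form P Y hY h0 h1 t, quantR_M P Y hY, split_int P Y hY h0 h1]
  have a1 : 0 ≤ ∫ v in Ioc (0:ℝ) u, max (quantR P Y v - t) 0 :=
    integral_nonneg (fun _ => le_max_right _ _)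
  have a2 : ∫ v in Ioo u 1, (quantR P Y v - t) ≤ ∫ v in Ioo u 1, max (quantR P Y v - t) 0 :=
    integral_mono hi2 hi2.pos_part (fun _ => le_max_left _ _)
  have : 0 ≤ (1 - u)⁻¹ := inv_nonneg.2 (by linarith)
  gcongr
  linarith

theorem avar_eq (hY : Integrable Y P) {u : ℝ} (h0 : 0 < u) (h1 : u < 1) :
    avarR P u Y = quantR P Y u + (1 - u)⁻¹ * ∫ ω, max (Y ω - quantR P Y u) 0 ∂P := by
  rw [avar_form P Y hY h0 h1 (quantR P Y u), quantR_M P Y hY, split_int P Y hY h0 h1]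
  have a1 : ∫ v in Ioc (0:ℝ) u, max (quantR P Y v - quantR P Y u) 0 = 0 := by
    rw [setIntegral_congr_fun (g := fun _ => (0:ℝ)) measurableSet_Ioc]
    · simp
    · intro v hv
      have := quantR_mono P Y hY ⟨hv.1, lt_of_le_of_lt hv.2 h1⟩ ⟨h0, h1⟩ hv.2
      exact max_eq_right (by linarith)
  have a2 : ∫ v in Ioo u 1, max (quantR P Y v - quantR P Y u) 0 =
      ∫ v in Ioo u 1, (quantR P Y v - quantR P Y u) := by
    refine setIntegral_congr_fun measurableSet_Ioo ?_
    intro v hv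
    have := quantR_mono P Y hY ⟨h0, h1⟩ ⟨h0.trans hv.1, hv.2⟩ hv.1.le
    exact max_eq_left (by linarith)
  rw [a1, a2, zero_add]

theorem M_int (hY : Integrable Y P) (t : ℝ) : Integrable (fun ω => max (Y ω - t) 0) P :=
  (hY.sub (integrable_const t)).pos_part

theorem M_tendsto (hY : Integrable Y P) :
    Filter.Tendsto (fun n : ℕ => ∫ ω, max (Y ω - (n:ℝ)) 0 ∂P) Filter.atTop (nhds 0) := by
  have h00 : ∫ ω, (fun _ : Ω => (0:ℝ)) ω ∂P = 0 := by simp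
  refine Eq.subst (motive := fun c => Filter.Tendsto (fun n : ℕ => ∫ ω, max (Y ω - (n:ℝ)) 0 ∂P)
    Filter.atTop (nhds c)) h00 ?_
  refine tendsto_integral_of_dominated_convergence (f := fun _ : Ω => (0:ℝ))
    (F := fun (n : ℕ) ω => max (Y ω - (n:ℝ)) 0) (fun ω => |Y ω|)
    (fun n => (M_int P Y hY n).aestronglyMeasurable) hY.abs ?_ ?_
  · intro n
    refine Filter.Eventually.of_forall (fun ω => ?_)
    have : (0:ℝ) ≤ n := Nat.cast_nonneg n
    rw [Real.norm_eq_abs, abs_of_nonneg (le_max_right _ _)]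
    exact max_le (by linarith [le_abs_self (Y ω)]) (abs_nonneg _)
  · refine Filter.Eventually.of_forall (fun ω => ?_)
    refine tendsto_const_nhds.congr' ?_
    obtain ⟨N, hN⟩ := exists_nat_ge (Y ω)
    filter_upwards [Filter.eventually_ge_atTop N] with n hn
    have : (N:ℝ) ≤ n := by exact_mod_cast hn
    exact (max_eq_right (by linarith)).symm

theorem M_anti (hY : Integrable Y P) {t s : ℝ} (h : t ≤ s) :
    ∫ ω, max (Y ω - s) 0 ∂P ≤ ∫ ω, max (Y ω - t) 0 ∂P :=
  integral_mono (M_int P Y hY s) (M_int P Y hY t)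
    (fun ω => max_le_max (by linarith) le_rfl)

theorem M_lip (hY : Integrable Y P) {t s : ℝ} (h : t ≤ s) :
    t + ∫ ω, max (Y ω - t) 0 ∂P ≤ s + ∫ ω, max (Y ω - s) 0 ∂P := by
  have : ∫ ω, max (Y ω - t) 0 ∂P ≤ ∫ ω, ((s - t) + max (Y ω - s) 0) ∂P := by
    refine integral_mono (M_int P Y hY t) ((integrable_const _).add (M_int P Y hY s)) ?_
    intro ω
    show max (Y ω - t) 0 ≤ (s - t) + max (Y ω - s) 0
    refine max_le ?_ ?_
    · linarith [le_max_left (Y ω - s) 0]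
    · linarith [le_max_right (Y ω - s) 0]
  rw [integral_add (integrable_const _) (M_int P Y hY s)] at this
  simp at this
  linarith

theorem M_conv (hY : Integrable Y P) (t s p r : ℝ) (hp : 0 < p) (hr : 0 < r) (hpr : p + r = 1) :
    ∫ ω, max (Y ω - (p * t + r * s)) 0 ∂P ≤
      p * ∫ ω, max (Y ω - t) 0 ∂P + r * ∫ ω, max (Y ω - s) 0 ∂P := by
  rw [← integral_const_mul, ← integral_const_mul,
    ← integral_add ((M_int P Y hY t).const_mul p) ((M_int P Y hY s).const_mul r)]
  refine integral_mono (M_int P Y hY _)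
    (((M_int P Y hY t).const_mul p).add ((M_int P Y hY s).const_mul r)) ?_
  intro ω
  show max (Y ω - (p * t + r * s)) 0 ≤ p * max (Y ω - t) 0 + r * max (Y ω - s) 0
  have e1 := mul_le_mul_of_nonneg_left (le_max_left (Y ω - t) 0) hp.le
  have e2 := mul_le_mul_of_nonneg_left (le_max_left (Y ω - s) 0) hr.le
  refine max_le ?_ (by positivity)
  have : Y ω = p * Y ω + r * Y ω := by rw [← add_mul, hpr, one_mul]
  linarith

theorem expect_eq (hY : Integrable Y P) (α η t x : ℝ) (hα : 1 / 2 < α) (hα1 : α < 1)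
    (hη : η = (1 - α) / α)
    (he : (1 - α) * ∫ ω, max (x - max (Y ω - t) 0) 0 ∂P =
      α * ∫ ω, max (max (Y ω - t) 0 - x) 0 ∂P) :
    0 ≤ x ∧ (1 - η) * ∫ ω, max (Y ω - (t + x)) 0 ∂P + η * ∫ ω, max (Y ω - t) 0 ∂P = η * x := by
  have hM0 : 0 ≤ ∫ ω, max (Y ω - t) 0 ∂P := integral_nonneg (fun _ => le_max_right _ _)
  have hx : 0 ≤ x := by
    by_contra hx
    push Not at hx
    have a1 : ∀ ω, max (x - max (Y ω - t) 0) 0 = 0 := fun ω =>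
      max_eq_right (by linarith [le_max_right (Y ω - t) 0])
    have a2 : ∀ ω, max (max (Y ω - t) 0 - x) 0 = max (Y ω - t) 0 - x := fun ω =>
      max_eq_left (by linarith [le_max_right (Y ω - t) 0])
    simp only [a1, a2] at he
    rw [integral_sub (M_int P Y hY t) (integrable_const _)] at he
    simp at he
    rcases he with h | h <;> linarith
  refine ⟨hx, ?_⟩
  have a2 : ∀ ω, max (max (Y ω - t) 0 - x) 0 = max (Y ω - (t + x)) 0 := by
    intro ω
    rcases le_total (Y ω - t) 0 with h | h
    · rw [max_eq_right h, max_eq_right (by linarith), max_eq_right (by linarith)]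
    · rw [max_eq_left h]; congr 1; ring
  have a1 : ∀ ω, max (x - max (Y ω - t) 0) 0 = x - max (Y ω - t) 0 + max (Y ω - (t + x)) 0 := by
    intro ω
    rw [← a2]
    generalize max (Y ω - t) 0 = w
    rcases le_total w x with h | h
    · rw [max_eq_left (by linarith), max_eq_right (by linarith)]; ring
    · rw [max_eq_right (by linarith), max_eq_left (by linarith)]; ring
  simp only [a1, a2] at he
  have hI : Integrable (fun ω => x - max (Y ω - t) 0) P :=
    (integrable_const x).sub (M_int P Y hY t)
  rw [integral_add hI (M_int P Y hY _),
    integral_sub (integrable_const _) (M_int P Y hY t)] at he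
  simp at he
  have : α ≠ 0 := by linarith
  rw [hη]
  field_simp
  linarith

end quant

/-- saddle function -/
noncomputable def LL (M : ℝ → ℝ) (η β γ t s : ℝ) : ℝ :=
  t + (1 - β)⁻¹ * (γ * (s - t) + (1 - γ) * ((1 / η - 1) * M s + M t))

theorem LL_case1 (M : ℝ → ℝ) (η β γ t s : ℝ) (hη0 : 0 < η) (hη1 : η < 1)
    (hβ1 : β < 1) (hγ0 : 0 < γ) (hγ1 : γ ≤ 1 - η) (hc : γ / (1 - β) < 1 - η) :
    LL M η β γ t s = (1 - γ / (1 - β)) * (t + (1 - β / (1 - γ))⁻¹ * M t) +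
      (γ / (1 - β)) * (s + (1 - (1 - (γ / (1 - γ)) * (η / (1 - η))))⁻¹ * M s) := by
  rw [div_lt_iff₀ (by linarith)] at hc
  have h1 : 1 - β ≠ 0 := by linarith
  have h2 : 1 - γ ≠ 0 := by linarith
  have h3 : 1 - η ≠ 0 := by linarith
  have h4 : 1 - γ - β ≠ 0 := by nlinarith
  have e1 : (1 - β / (1 - γ))⁻¹ = (1 - γ) / (1 - γ - β) := by
    rw [← inv_div]; congr 1; field_simp
  have e2 : (1 - (1 - (γ / (1 - γ)) * (η / (1 - η))))⁻¹ = (1 - γ) * (1 - η) / (γ * η) := by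
    rw [← inv_div]; congr 1; field_simp; ring
  rw [e1, e2]
  have e3 : 1 - γ / (1 - β) = (1 - γ - β) / (1 - β) := by field_simp; ring
  rw [e3]
  unfold LL
  field_simp
  ring

theorem LL_case2 (M : ℝ → ℝ) (η β γ t s : ℝ) (hη0 : 0 < η) (hη1 : η < 1)
    (hβ1 : β < 1) (hγ1 : γ ≤ 1 - η) :
    LL M η β γ t s = η * (t + (1 - (1 - (1 - β) * η / (1 - γ)))⁻¹ * M t) +
      (1 - η) * (s + (1 - (1 - (1 - β) * η / (1 - γ)))⁻¹ * M s) +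
      (γ / (1 - β) - (1 - η)) * (s - t) := by
  have h1 : 1 - β ≠ 0 := by linarith
  have h2 : 1 - γ ≠ 0 := by linarith
  have e2 : (1 - (1 - (1 - β) * η / (1 - γ)))⁻¹ = (1 - γ) / ((1 - β) * η) := by
    rw [sub_sub_cancel, inv_div]
  rw [e2]
  unfold LL
  field_simp
  ring

theorem stmt19 {Ω : Type*} [MeasurableSpace Ω] (P : Measure Ω) [IsProbabilityMeasure P]
    (α : ℝ) (hα : α ∈ Set.Ioo (1 / 2 : ℝ) 1)
    (η : ℝ) (hη : η = (1 - α) / α)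
    (β : ℝ) (hβ : β ∈ Set.Ioo (0 : ℝ) 1)
    (Y : Ω → ℝ) (hY : Integrable Y P)
    -- the expectile e_α, characterized by its first order condition
    (e : (Ω → ℝ) → ℝ)
    (he : ∀ W : Ω → ℝ, Integrable W P →
      (1 - α) * ∫ ω, max (e W - W ω) 0 ∂P = α * ∫ ω, max (W ω - e W) 0 ∂P) :
    (⨅ t : ℝ, t + (1 - β)⁻¹ * e (fun ω => max (Y ω - t) 0)) =
    sSup ((fun γ =>
      if γ / (1 - β) < 1 - η then
        (1 - γ / (1 - β)) * avarR P (β / (1 - γ)) Y +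
          (γ / (1 - β)) * avarR P (1 - (γ / (1 - γ)) * (η / (1 - η))) Y
      else
        avarR P (1 - (1 - β) * η / (1 - γ)) Y) '' Set.Icc (0 : ℝ) (1 - η)) := by
  obtain ⟨hα0, hα1⟩ := hα
  obtain ⟨hβ0, hβ1⟩ := hβ
  have hη0 : 0 < η := by rw [hη]; exact div_pos (by linarith) (by linarith)
  have hη1 : η < 1 := by rw [hη, div_lt_one (by linarith)]; linarith
  set M : ℝ → ℝ := fun t => ∫ ω, max (Y ω - t) 0 ∂P with hM
  have hM0 : ∀ t, 0 ≤ M t := fun t => integral_nonneg (fun _ => le_max_right _ _)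
  have hManti : ∀ {t s}, t ≤ s → M s ≤ M t := fun h => M_anti P Y hY h
  have hMlip : ∀ {t s}, t ≤ s → t + M t ≤ s + M s := fun h => M_lip P Y hY h
  have hMlim : Filter.Tendsto (fun n : ℕ => M n) Filter.atTop (nhds 0) := M_tendsto P Y hY
  have hMconv : ∀ t s p r : ℝ, 0 < p → 0 < r → p + r = 1 →
      M (p * t + r * s) ≤ p * M t + r * M s := M_conv P Y hY
  have hle : ∀ {u : ℝ}, 0 < u → u < 1 → ∀ t, avarR P u Y ≤ t + (1 - u)⁻¹ * M t :=
    fun h0 h1 t => avar_le P Y hY h0 h1 t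
  have heq : ∀ {u : ℝ}, 0 < u → u < 1 →
      avarR P u Y = quantR P Y u + (1 - u)⁻¹ * M (quantR P Y u) :=
    fun h0 h1 => avar_eq P Y hY h0 h1
  have hmono := quantR_mono P Y hY
  have hx : ∀ t, 0 ≤ e (fun ω => max (Y ω - t) 0) ∧
      (1 - η) * M (t + e (fun ω => max (Y ω - t) 0)) + η * M t =
        η * e (fun ω => max (Y ω - t) 0) :=
    fun t => expect_eq P Y hY α η t _ hα0 hα1 hη (he _ (M_int P Y hY t))
  clear_value M
  set E : ℝ → ℝ := fun t => e (fun ω => max (Y ω - t) 0) with hE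
  change ∀ t, 0 ≤ E t ∧ (1 - η) * M (t + E t) + η * M t = η * E t at hx
  change (⨅ t : ℝ, t + (1 - β)⁻¹ * E t) = _
  clear_value E
  set g : ℝ → ℝ := fun γ =>
      if γ / (1 - β) < 1 - η then
        (1 - γ / (1 - β)) * avarR P (β / (1 - γ)) Y +
          (γ / (1 - β)) * avarR P (1 - (γ / (1 - γ)) * (η / (1 - η))) Y
      else
        avarR P (1 - (1 - β) * η / (1 - γ)) Y with hg
  have hc0 : 0 < (1 - β)⁻¹ := inv_pos.2 (by linarith)
  have hk0 : 0 < 1 / η - 1 := by rw [sub_pos, lt_div_iff₀ hη0]; linarith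
  have hηk : η * (1 / η - 1) = 1 - η := by field_simp
  -- levels
  have hu1 : ∀ γ, 0 ≤ γ → γ ≤ 1 - η → γ / (1 - β) < 1 - η →
      0 < β / (1 - γ) ∧ β / (1 - γ) < 1 ∧ 0 < 1 - γ / (1 - β) := by
    intro γ h0 h1 h
    rw [div_lt_iff₀ (by linarith)] at h
    refine ⟨div_pos hβ0 (by linarith), ?_, ?_⟩
    · rw [div_lt_one (by linarith)]; nlinarith
    · rw [sub_pos, div_lt_one (by linarith)]; nlinarith
  have ha : ∀ γ, 0 < γ → γ ≤ 1 - η → γ / (1 - β) < 1 - η →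
      β / (1 - γ) ≤ 1 - (γ / (1 - γ)) * (η / (1 - η)) ∧
      1 - (γ / (1 - γ)) * (η / (1 - η)) < 1 := by
    intro γ h0 h1 h
    rw [div_lt_iff₀ (by linarith)] at h
    have i1 : 0 < 1 - γ := by linarith
    have i2 : 0 < 1 - η := by linarith
    refine ⟨?_, ?_⟩
    · have : 1 - (γ / (1 - γ)) * (η / (1 - η)) = (1 - γ / (1 - η)) / (1 - γ) := by
        field_simp; ring
      rw [this]
      refine div_le_div_of_nonneg_right ?_ i1.le
      have : γ / (1 - η) ≤ 1 - β := by rw [div_le_iff₀ i2]; linarith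
      linarith
    · have : 0 < (γ / (1 - γ)) * (η / (1 - η)) := by positivity
      linarith
  have hu2 : ∀ γ, 0 ≤ γ → γ ≤ 1 - η →
      0 < 1 - (1 - β) * η / (1 - γ) ∧ 1 - (1 - β) * η / (1 - γ) < 1 := by
    intro γ h0 h1
    have i1 : 0 < 1 - γ := by linarith
    have i3 : 0 < 1 - β := by linarith
    constructor
    · rw [sub_pos, div_lt_one i1]; nlinarith
    · have : 0 < (1 - β) * η / (1 - γ) := by positivity
      linarith
  have step1 : ∀ γ, 0 ≤ γ → γ ≤ 1 - η → ∀ t s, t ≤ s → g γ ≤ LL M η β γ t s := by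
    intro γ h0 h1 t s hts
    simp only [hg]
    split_ifs with h
    · obtain ⟨p1, p2, p3⟩ := hu1 γ h0 h1 h
      rcases h0.eq_or_lt with rfl | h0'
      · have := hle hβ0 hβ1 t
        have : 0 ≤ (1 - β)⁻¹ * ((1 / η - 1) * M s) := by have := hM0 s; positivity
        simp [LL] at *
        linarith
      · obtain ⟨q1, q2⟩ := ha γ h0' h1 h
        rw [LL_case1 M η β γ t s hη0 hη1 hβ1 h0' h1 h]
        have i1 : 0 ≤ γ / (1 - β) := div_nonneg h0 (by linarith)
        exact add_le_add (mul_le_mul_of_nonneg_left (hle p1 p2 t) p3.le)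
          (mul_le_mul_of_nonneg_left (hle (p1.trans_le q1) q2 s) i1)
    · push Not at h
      obtain ⟨p1, p2⟩ := hu2 γ h0 h1
      rw [LL_case2 M η β γ t s hη0 hη1 hβ1 h1]
      have a1 := mul_le_mul_of_nonneg_left (hle p1 p2 t) hη0.le
      have a2 := mul_le_mul_of_nonneg_left (hle p1 p2 s) (sub_nonneg.2 hη1.le)
      have a3 : 0 ≤ (γ / (1 - β) - (1 - η)) * (s - t) :=
        mul_nonneg (by linarith) (by linarith)
      linarith
  have step2 : ∀ γ, 0 ≤ γ → γ ≤ 1 - η → ∀ w, (∀ t s, t ≤ s → w ≤ LL M η β γ t s) →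
      w ≤ g γ := by
    intro γ h0 h1 w hw
    simp only [hg]
    split_ifs with h
    · obtain ⟨p1, p2, p3⟩ := hu1 γ h0 h1 h
      rcases h0.eq_or_lt with rfl | h0'
      · have hl : Filter.Tendsto (fun n : ℕ => LL M η β 0 (quantR P Y β) n) Filter.atTop
            (nhds (quantR P Y β + (1 - β)⁻¹ * (0 + (1 - 0) *
              ((1 / η - 1) * 0 + M (quantR P Y β))))) := by
          unfold LL
          simp only [zero_mul]
          exact tendsto_const_nhds.add ((tendsto_const_nhds.add
            (((hMlim.const_mul _).add tendsto_const_nhds).const_mul _)).const_mul _)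
        have := ge_of_tendsto hl (b := w) (by
          obtain ⟨N, hN⟩ := exists_nat_ge (quantR P Y β)
          filter_upwards [Filter.eventually_ge_atTop N] with n hn
          exact hw _ _ (hN.trans (by exact_mod_cast hn)))
        have h3 := heq hβ0 hβ1
        simp at *
        linarith
      · obtain ⟨q1, q2⟩ := ha γ h0' h1 h
        rw [heq p1 p2, heq (p1.trans_le q1) q2,
          ← LL_case1 M η β γ _ _ hη0 hη1 hβ1 h0' h1 h]
        exact hw _ _ (hmono ⟨p1, p2⟩ ⟨p1.trans_le q1, q2⟩ q1)
    · obtain ⟨p1, p2⟩ := hu2 γ h0 h1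
      have := hw (quantR P Y (1 - (1 - β) * η / (1 - γ)))
        (quantR P Y (1 - (1 - β) * η / (1 - γ))) le_rfl
      rw [LL_case2 M η β γ _ _ hη0 hη1 hβ1 h1, ← heq p1 p2] at this
      linarith
  -- value at the expectile
  have hHE : ∀ t, (1 / η - 1) * M (t + E t) + M t = E t := by
    intro t
    have := (hx t).2
    apply mul_left_cancel₀ hη0.ne'
    rw [mul_add, ← mul_assoc, hηk]
    exact this
  have hval : ∀ γ t, LL M η β γ t (t + E t) = t + (1 - β)⁻¹ * E t := by
    intro γ t
    unfold LL
    rw [hHE]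
    ring
  have hub : ∀ γ, 0 ≤ γ → γ ≤ 1 - η → ∀ t, g γ ≤ t + (1 - β)⁻¹ * E t := by
    intro γ h0 h1 t
    rw [← hval γ t]
    exact step1 γ h0 h1 _ _ (by linarith [(hx t).1])
  have hbb : BddBelow (range fun t : ℝ => t + (1 - β)⁻¹ * E t) :=
    ⟨g 0, by rintro _ ⟨t, rfl⟩; exact hub 0 le_rfl (by linarith) t⟩
  apply le_antisymm
  · set v := ⨅ t : ℝ, t + (1 - β)⁻¹ * E t with hv
    have hvle : ∀ t, v ≤ t + (1 - β)⁻¹ * E t := fun t => ciInf_le hbb t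
    obtain ⟨θ, hθ0, hθ1, hθ⟩ := minimax_aux {z : ℝ × ℝ | z.1 ≤ z.2}
      (fun z => LL M η β 0 z.1 z.2 - v) (fun z => LL M η β (1 - η) z.1 z.2 - v) (by
        rintro ⟨t, s⟩ hz ⟨t', s'⟩ hw p r hp hr hpr
        simp only [mem_ofPred_eq] at hz hw
        have m1 := hMconv t t' p r hp hr hpr
        have m2 := hMconv s s' p r hp hr hpr
        have key : ∀ γ, 0 ≤ γ → γ ≤ 1 - η →
            LL M η β γ (p * t + r * t') (p * s + r * s') - v ≤
            p * (LL M η β γ t s - v) + r * (LL M η β γ t' s' - v) := by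
          intro γ h0 h1
          have e0 : p * (LL M η β γ t s - v) + r * (LL M η β γ t' s' - v) =
              p * LL M η β γ t s + r * LL M η β γ t' s' - v := by
            have : v = (p + r) * v := by rw [hpr, one_mul]
            linarith
          rw [e0]
          have i1 : 0 ≤ 1 - γ := by linarith
          have m3 : (1 / η - 1) * M (p * s + r * s') + M (p * t + r * t') ≤
            (1 / η - 1) * (p * M s + r * M s') + (p * M t + r * M t') :=
            add_le_add (mul_le_mul_of_nonneg_left m2 hk0.le) m1
          have m4 := mul_le_mul_of_nonneg_left (mul_le_mul_of_nonneg_left m3 i1) hc0.le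
          unfold LL
          linarith
        refine ⟨(p * t + r * t', p * s + r * s'), ?_, ?_, ?_⟩
        · simp only [mem_ofPred_eq]
          gcongr
        · exact key 0 le_rfl (by linarith)
        · exact key (1 - η) (by linarith) le_rfl) (by
        rintro ⟨t, s⟩ hz
        simp only [mem_ofPred_eq] at hz
        have h1 := hvle t
        have h2 := hHE t
        rcases le_total s (t + E t) with h | h
        · left
          have h3 := mul_le_mul_of_nonneg_left (hManti h) hk0.le
          have h4 : E t ≤ 0 * (s - t) + (1 - 0) * ((1 / η - 1) * M s + M t) := by linarith
          have h5 := mul_le_mul_of_nonneg_left h4 hc0.le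
          simp only [LL]
          linarith
        · right
          have h3 := mul_le_mul_of_nonneg_left (hMlip h) (sub_nonneg.2 hη1.le)
          have h6 := (hx t).2
          have h4 : E t ≤ (1 - η) * (s - t) + (1 - (1 - η)) * ((1 / η - 1) * M s + M t) := by
            have : (1 - (1 - η)) * ((1 / η - 1) * M s + M t) = (1 - η) * M s + η * M t := by
              rw [sub_sub_cancel, mul_add, ← mul_assoc, hηk]
            rw [this]
            linarith
          have h5 := mul_le_mul_of_nonneg_left h4 hc0.le
          simp only [LL]
          linarith)
    have hγ0 : 0 ≤ θ * (1 - η) := mul_nonneg hθ0 (by linarith)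
    have hγ1 : θ * (1 - η) ≤ 1 - η := by nlinarith
    have hvg : v ≤ g (θ * (1 - η)) := by
      refine step2 _ hγ0 hγ1 v ?_
      intro t s hts
      have h1 := hθ (t, s) hts
      have h2 : LL M η β (θ * (1 - η)) t s - v = (1 - θ) * (LL M η β 0 t s - v) +
          θ * (LL M η β (1 - η) t s - v) := by
        unfold LL; ring
      simp only at h1
      linarith
    refine hvg.trans (le_csSup ⟨0 + (1 - β)⁻¹ * E 0, ?_⟩ ⟨_, ⟨hγ0, hγ1⟩, rfl⟩)
    rintro _ ⟨γ, ⟨h0, h1⟩, rfl⟩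
    exact hub γ h0 h1 0
  · refine csSup_le ⟨_, ⟨0, ⟨le_rfl, by linarith⟩, rfl⟩⟩ ?_
    rintro _ ⟨γ, ⟨h0, h1⟩, rfl⟩
    exact le_ciInf (fun t => hub γ h0 h1 t)
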